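/- There exists a constant γ>0 such that, with probability tending to 1 as n → ∞, a random graph G ~ G(n,1/2) has the property that every bisection A∪B of G satisfies |Δ_{A,B}| < γ n^{3/2}. -/

import Mathlib

open Finset Filter

open scoped Classical

/-- The number of neighbours of `v` (in the graph `G`) lying in the set `S`. -/
noncomputable def degIn {n : ℕ} (G : SimpleGraph (Fin n)) (S : Finset (Fin n)) (v : Fin n) : ℕ :=
  (S.filter fun w => G.Adj v w).card

/-- The friendliness of a vertex `v` with respect to the bisection `A ∪ Aᶜ`:
the number of neighbours in its own part minus the number of neighbours across. -/
noncomputable def friendliness {n : ℕ} (G : SimpleGraph (Fin n)) (A : Finset (Fin n))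
    (v : Fin n) : ℤ :=
  if v ∈ A then (degIn G A v : ℤ) - (degIn G Aᶜ v : ℤ)
  else (degIn G Aᶜ v : ℤ) - (degIn G A v : ℤ)

/-- `A ∪ Aᶜ` is a bisection: the parts' sizes differ by at most one. -/
def IsBisection {n : ℕ} (A : Finset (Fin n)) : Prop :=
  |(A.card : ℤ) - (Aᶜ.card : ℤ)| ≤ 1

/-- The probability, under the uniform measure on simple graphs on `Fin n`
(i.e. the Erdős–Rényi measure `G(n,1/2)`), of the set of graphs satisfying `P`. -/
noncomputable def graphProb (n : ℕ) (P : SimpleGraph (Fin n) → Prop) : ℝ :=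
  ((univ.filter P).card : ℝ) / (Fintype.card (SimpleGraph (Fin n)) : ℝ)

/-- The total friendliness of the bisection `A ∪ Aᶜ`. -/
noncomputable def totalFriendliness {n : ℕ} (G : SimpleGraph (Fin n))
    (A : Finset (Fin n)) : ℤ :=
  ∑ v, friendliness G A v

/-- The `±1` indicator of a set of vertices. -/
noncomputable def partSign {n : ℕ} (A : Finset (Fin n)) (v : Fin n) : ℝ :=
  if v ∈ A then 1 else -1

/-- The pairs `(i, j)` with `i < j`, representing the possible edges. -/
def orderedPairs (n : ℕ) : Finset (Fin n × Fin n) :=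
  univ.filter fun p => p.1 < p.2

/-- The total friendliness, centred by replacing each edge indicator by a `±1` variable. -/
noncomputable def signedSum {n : ℕ} (G : SimpleGraph (Fin n)) (A : Finset (Fin n)) : ℝ :=
  ∑ p ∈ orderedPairs n,
    if G.Adj p.1 p.2 then partSign A p.1 * partSign A p.2
    else -(partSign A p.1 * partSign A p.2)

lemma sum_symm_eq_two_mul {n : ℕ} (f : Fin n → Fin n → ℝ) (hsymm : ∀ v w, f v w = f w v)
    (hdiag : ∀ v, f v v = 0) :
    ∑ v, ∑ w, f v w = 2 * ∑ p ∈ orderedPairs n, f p.1 p.2 := by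
  have hsplit : ∀ v w : Fin n,
      f v w = (if v < w then f v w else 0) + (if w < v then f w v else 0) := by
    intro v w
    rcases lt_trichotomy v w with h | h | h
    · simp [h, h.not_gt]
    · subst h; simp [hdiag]
    · simp [h, h.not_gt, hsymm v w]
  have hpairs : ∑ p ∈ orderedPairs n, f p.1 p.2 =
      ∑ v, ∑ w, if v < w then f v w else 0 := by
    rw [orderedPairs, sum_filter, ← univ_product_univ, sum_product]
  rw [hpairs, two_mul]
  nth_rewrite 3 [sum_comm]
  rw [← sum_add_distrib]
  refine sum_congr rfl fun v _ => ?_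
  rw [← sum_add_distrib]
  exact sum_congr rfl fun w _ => hsplit v w

lemma partSign_mul_self {n : ℕ} (A : Finset (Fin n)) (v : Fin n) :
    partSign A v * partSign A v = 1 := by
  unfold partSign; split_ifs <;> norm_num

lemma sum_partSign {n : ℕ} (A : Finset (Fin n)) :
    ∑ v, partSign A v = (A.card : ℝ) - (Aᶜ.card : ℝ) := by
  rw [← sum_add_sum_compl A]
  rw [sum_congr rfl (g := fun _ => (1 : ℝ)) (fun v hv => by simp [partSign, hv]),
    sum_congr (s₁ := Aᶜ) rfl (g := fun _ => (-1 : ℝ))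
      (fun v hv => by simp [partSign, mem_compl.mp hv])]
  simp
  ring

lemma totalFriendliness_eq_sum {n : ℕ} (G : SimpleGraph (Fin n)) (A : Finset (Fin n)) :
    (totalFriendliness G A : ℝ) =
      ∑ v, ∑ w, if G.Adj v w then partSign A v * partSign A w else 0 := by
  unfold totalFriendliness
  push_cast
  refine sum_congr rfl fun v _ => ?_
  have hA : ∑ w ∈ A, (if G.Adj v w then partSign A v * partSign A w else 0) =
      partSign A v * degIn G A v := by
    rw [degIn, card_filter, Nat.cast_sum, mul_sum]
    refine sum_congr rfl fun w hw => ?_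
    by_cases h : G.Adj v w <;> simp [h, partSign, hw]
  have hAc : ∑ w ∈ Aᶜ, (if G.Adj v w then partSign A v * partSign A w else 0) =
      -(partSign A v * degIn G Aᶜ v) := by
    rw [degIn, card_filter, Nat.cast_sum, mul_sum, ← sum_neg_distrib]
    refine sum_congr rfl fun w hw => ?_
    by_cases h : G.Adj v w <;> simp [h, partSign, mem_compl.mp hw]
  rw [← sum_add_sum_compl A, hA, hAc]
  by_cases hv : v ∈ A <;> simp [friendliness, partSign, hv] <;> ring

lemma totalFriendliness_eq_signedSum {n : ℕ} (G : SimpleGraph (Fin n)) (A : Finset (Fin n)) :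
    (totalFriendliness G A : ℝ) =
      signedSum G A + (((A.card : ℝ) - (Aᶜ.card : ℝ)) ^ 2 - n) / 2 := by
  have hadj := sum_symm_eq_two_mul
    (fun v w => if G.Adj v w then partSign A v * partSign A w else 0)
    (fun v w => by simp only [G.adj_comm v w, mul_comm]) (fun v => by simp)
  have hall := sum_symm_eq_two_mul
    (fun v w => partSign A v * partSign A w - if v = w then 1 else 0)
    (fun v w => by simp only [eq_comm (a := v), mul_comm])
    (fun v => by simp [partSign_mul_self])
  have hsq : ∑ v, ∑ w, (partSign A v * partSign A w - if v = w then 1 else 0) =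
      ((A.card : ℝ) - (Aᶜ.card : ℝ)) ^ 2 - n := by
    simp only [sum_sub_distrib, ← mul_sum, ← sum_mul, sum_partSign]
    simp [sq]
  rw [totalFriendliness_eq_sum, hadj, ← hsq, hall, mul_div_cancel_left₀ _ two_ne_zero,
    signedSum, mul_sum, ← sum_add_distrib]
  refine sum_congr rfl fun p hp => ?_
  have hne : p.1 ≠ p.2 := (mem_filter.mp hp).2.ne
  by_cases h : G.Adj p.1 p.2
  · simp only [h, hne, if_true, if_false]; ring
  · simp only [h, hne, if_false]; ring

lemma abs_totalFriendliness_le {n : ℕ} (hn : 1 ≤ n) (G : SimpleGraph (Fin n))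
    {A : Finset (Fin n)} (hA : IsBisection A) :
    |(totalFriendliness G A : ℝ)| ≤ |signedSum G A| + n := by
  have hA' : |(A.card : ℝ) - (Aᶜ.card : ℝ)| ≤ 1 := by
    unfold IsBisection at hA
    exact_mod_cast hA
  have hsq : ((A.card : ℝ) - (Aᶜ.card : ℝ)) ^ 2 ≤ 1 := (sq_le_one_iff_abs_le_one _).mpr hA'
  have hn' : (1 : ℝ) ≤ n := by exact_mod_cast hn
  rw [totalFriendliness_eq_signedSum]
  refine (abs_add_le _ _).trans (add_le_add_right (abs_le.mpr ⟨?_, ?_⟩) _) <;>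
    nlinarith [sq_nonneg ((A.card : ℝ) - (Aᶜ.card : ℝ))]

/-- Summing over all graphs a product of edge-dependent factors. -/
lemma sum_graph_prod {n : ℕ} (f g : Fin n × Fin n → ℝ) :
    ∑ G : SimpleGraph (Fin n), ∏ p ∈ orderedPairs n, (if G.Adj p.1 p.2 then f p else g p) =
      ∏ p ∈ orderedPairs n, (f p + g p) := by
  rw [prod_add]
  refine sum_bij' (fun G _ => (orderedPairs n).filter fun p => G.Adj p.1 p.2)
    (fun t _ => SimpleGraph.fromRel fun v w => (v, w) ∈ t)
    (fun G _ => by simp) (fun t _ => mem_univ _) (fun G _ => ?_) (fun t ht => ?_)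
    (fun G _ => ?_)
  · ext v w
    simp only [SimpleGraph.fromRel_adj, mem_filter, orderedPairs, mem_univ, true_and,
      G.adj_comm w v]
    constructor
    · rintro ⟨_, h | h⟩ <;> exact h.2
    · intro h
      exact ⟨h.ne, h.ne.lt_or_gt.imp (⟨·, h⟩) (⟨·, h⟩)⟩
  · have hlt : ∀ p ∈ t, p.1 < p.2 := fun p hp => (mem_filter.mp (mem_powerset.mp ht hp)).2
    ext ⟨v, w⟩
    simp only [SimpleGraph.fromRel_adj, mem_filter, orderedPairs, mem_univ, true_and]
    constructor
    · rintro ⟨hvw, _, h | h⟩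
      · exact h
      · exact absurd (hlt _ h) hvw.not_gt
    · intro h
      exact ⟨hlt _ h, (hlt _ h).ne, Or.inl h⟩
  · rw [prod_ite, filter_not]

lemma card_simpleGraph_fin (n : ℕ) :
    (Fintype.card (SimpleGraph (Fin n)) : ℝ) = 2 ^ (orderedPairs n).card := by
  have h := sum_graph_prod (n := n) (fun _ => 1) (fun _ => 1)
  norm_num at h
  simpa using h

lemma card_orderedPairs_le (n : ℕ) : ((orderedPairs n).card : ℝ) ≤ (n : ℝ) ^ 2 / 2 := by
  have h := sum_symm_eq_two_mul (n := n) (fun v w => if v = w then 0 else 1)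
    (fun v w => by simp only [eq_comm]) (fun v => by simp)
  have hpairs : ∑ p ∈ orderedPairs n, (if p.1 = p.2 then (0 : ℝ) else 1) =
      (orderedPairs n).card := by
    rw [sum_congr rfl (g := fun _ => (1 : ℝ)) fun p hp => if_neg (mem_filter.mp hp).2.ne]
    simp
  have hle : ∑ v : Fin n, ∑ w : Fin n, (if v = w then (0 : ℝ) else 1) ≤
      ∑ v : Fin n, ∑ w : Fin n, 1 :=
    sum_le_sum fun v _ => sum_le_sum fun w _ => by split_ifs <;> norm_num
  rw [h, hpairs] at hle
  simp only [sum_const, card_univ, Fintype.card_fin, nsmul_eq_mul, mul_one] at hle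
  linarith

/-- The exponential moment bound for the centred friendliness. -/
lemma sum_exp_signedSum_le {n : ℕ} (A : Finset (Fin n)) (l : ℝ) :
    ∑ G : SimpleGraph (Fin n), Real.exp (l * signedSum G A) ≤
      Fintype.card (SimpleGraph (Fin n)) * Real.exp (n ^ 2 * l ^ 2 / 4) := by
  have hprod : ∀ G : SimpleGraph (Fin n), Real.exp (l * signedSum G A) =
      ∏ p ∈ orderedPairs n, if G.Adj p.1 p.2
        then Real.exp (l * (partSign A p.1 * partSign A p.2))
        else Real.exp (-(l * (partSign A p.1 * partSign A p.2))) := by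
    intro G
    rw [signedSum, mul_sum, Real.exp_sum]
    refine prod_congr rfl fun p _ => ?_
    split_ifs <;> simp
  have hfactor : ∀ p ∈ orderedPairs n,
      Real.exp (l * (partSign A p.1 * partSign A p.2)) +
        Real.exp (-(l * (partSign A p.1 * partSign A p.2))) ≤ 2 * Real.exp (l ^ 2 / 2) := by
    intro p _
    have h := Real.cosh_le_exp_half_sq (l * (partSign A p.1 * partSign A p.2))
    have hsq : (l * (partSign A p.1 * partSign A p.2)) ^ 2 = l ^ 2 := by
      linear_combination l ^ 2 * (partSign A p.2 * partSign A p.2) * partSign_mul_self A p.1 +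
        l ^ 2 * partSign_mul_self A p.2
    rw [hsq, Real.cosh_eq] at h
    linarith
  simp only [hprod]
  rw [sum_graph_prod (fun p => Real.exp (l * (partSign A p.1 * partSign A p.2)))
    (fun p => Real.exp (-(l * (partSign A p.1 * partSign A p.2))))]
  refine (prod_le_prod (fun p _ => by positivity) hfactor).trans ?_
  rw [prod_const, mul_pow, card_simpleGraph_fin, ← Real.exp_nat_mul]
  gcongr
  nlinarith [card_orderedPairs_le n, sq_nonneg l]

lemma card_large_signedSum_mul_exp_le (n : ℕ) {l t : ℝ} (hl : 0 ≤ l) :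
    ((univ.filter fun G : SimpleGraph (Fin n) =>
        ∃ A : Finset (Fin n), t ≤ |signedSum G A|).card : ℝ) * Real.exp (l * t) ≤
      2 ^ n * (2 * (Fintype.card (SimpleGraph (Fin n)) * Real.exp (n ^ 2 * l ^ 2 / 4))) := by
  calc _ = ∑ G : SimpleGraph (Fin n) with ∃ A : Finset (Fin n), t ≤ |signedSum G A|,
        Real.exp (l * t) := by rw [sum_const, nsmul_eq_mul]
    _ ≤ ∑ G : SimpleGraph (Fin n) with ∃ A : Finset (Fin n), t ≤ |signedSum G A|,
        ∑ A : Finset (Fin n),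
          (Real.exp (l * signedSum G A) + Real.exp (-l * signedSum G A)) := by
      refine sum_le_sum fun G hG => ?_
      obtain ⟨A, hA⟩ := (mem_filter.mp hG).2
      refine le_trans ?_ (single_le_sum
        (f := fun A => Real.exp (l * signedSum G A) + Real.exp (-l * signedSum G A))
        (fun B _ => by positivity) (mem_univ A))
      rcases le_abs.mp hA with h | h
      · exact (Real.exp_le_exp.mpr (by gcongr)).trans
          (le_add_of_nonneg_right (Real.exp_pos _).le)
      · exact (Real.exp_le_exp.mpr (by nlinarith)).trans
          (le_add_of_nonneg_left (Real.exp_pos _).le)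
    _ ≤ ∑ G : SimpleGraph (Fin n), ∑ A : Finset (Fin n),
          (Real.exp (l * signedSum G A) + Real.exp (-l * signedSum G A)) :=
      sum_le_sum_of_subset_of_nonneg (filter_subset _ _)
        fun G _ _ => sum_nonneg fun A _ => by positivity
    _ ≤ ∑ _A : Finset (Fin n),
          2 * (Fintype.card (SimpleGraph (Fin n)) * Real.exp (n ^ 2 * l ^ 2 / 4)) := by
      rw [sum_comm]
      refine sum_le_sum fun A _ => ?_
      rw [sum_add_distrib, two_mul]
      refine add_le_add (sum_exp_signedSum_le A l) ?_
      simpa using sum_exp_signedSum_le A (-l)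
    _ = _ := by simp

lemma one_sub_le_graphProb {n : ℕ} (hn : 1 ≤ n) :
    1 - 2 * Real.exp (-(2 * n : ℝ)) ≤
      graphProb n (fun G => ∀ A : Finset (Fin n), IsBisection A →
        |(totalFriendliness G A : ℝ)| < 4 * (n : ℝ) ^ (3 / 2 : ℝ)) := by
  have hn' : (1 : ℝ) ≤ n := by exact_mod_cast hn
  set r := √(n : ℝ)
  have hr : r * r = n := Real.mul_self_sqrt (by positivity)
  have hr0 : 0 < r := Real.sqrt_pos.mpr (by positivity)
  have hpow : (n : ℝ) ^ (3 / 2 : ℝ) = n * r := by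
    rw [show (3 / 2 : ℝ) = 1 + 1 / 2 by norm_num, Real.rpow_add (by positivity),
      Real.rpow_one, ← Real.sqrt_eq_rpow]
  have hr1 : 1 ≤ r := Real.one_le_sqrt.mpr hn'
  set N : ℝ := (Fintype.card (SimpleGraph (Fin n)) : ℝ)
  have hN : 0 < N := by
    have : 0 < Fintype.card (SimpleGraph (Fin n)) := Fintype.card_pos
    exact Nat.cast_pos.mpr this
  set good := univ.filter fun G : SimpleGraph (Fin n) => ∀ A : Finset (Fin n), IsBisection A →
        |(totalFriendliness G A : ℝ)| < 4 * (n : ℝ) ^ (3 / 2 : ℝ) with hgood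
  set bad := univ.filter fun G : SimpleGraph (Fin n) =>
        ∃ A : Finset (Fin n), 2 * (n * r) ≤ |signedSum G A| with hbad
  have hcover : N ≤ good.card + bad.card := by
    have hsub : (univ : Finset (SimpleGraph (Fin n))) ⊆ good ∪ bad := by
      intro G _
      by_contra hG
      simp only [hgood, hbad, mem_union, mem_filter, mem_univ, true_and, not_or,
        not_exists, not_le] at hG
      refine hG.1 fun A hA => ?_
      rw [hpow]
      nlinarith [abs_totalFriendliness_le hn G hA, hG.2 A]
    have h := (card_le_card hsub).trans (card_union_le _ _)
    rw [card_univ] at h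
    exact (Nat.cast_le.mpr h).trans_eq (Nat.cast_add _ _)
  have hbound := card_large_signedSum_mul_exp_le n (l := 2 / r) (t := 2 * (n * r))
    (by positivity)
  have hexp : 2 / r * (2 * (n * r)) = 4 * n := by field_simp; ring
  have hexp' : (n : ℝ) ^ 2 * (2 / r) ^ 2 / 4 = n := by
    rw [div_pow, sq r, hr]; field_simp; ring
  rw [hexp, hexp', ← hbad] at hbound
  have htwo : (2 : ℝ) ^ n ≤ Real.exp n := by
    rw [← mul_one (n : ℝ), Real.exp_nat_mul]
    gcongr
    linarith [Real.add_one_le_exp (1 : ℝ)]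
  have hbadN : (bad.card : ℝ) ≤ 2 * Real.exp (-(2 * n : ℝ)) * N := by
    refine le_of_mul_le_mul_right (hbound.trans ?_) (Real.exp_pos (4 * n))
    calc _ ≤ Real.exp n * (2 * (N * Real.exp n)) := by gcongr
      _ = 2 * N * (Real.exp n * Real.exp n) := by ring
      _ = 2 * N * (Real.exp (-(2 * n)) * Real.exp (4 * n)) := by
        rw [← Real.exp_add, ← Real.exp_add]; ring_nf
      _ = _ := by ring
  rw [graphProb, le_div_iff₀ hN]
  have hlower : (1 - 2 * Real.exp (-(2 * n : ℝ))) * N ≤ good.card := by linarith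
  refine hlower.trans_eq ?_
  rw [hgood]
  congr!

lemma graphProb_le_one (n : ℕ) (P : SimpleGraph (Fin n) → Prop) : graphProb n P ≤ 1 :=
  div_le_one_of_le₀ (by exact_mod_cast card_le_univ _) (by positivity)

/-- there is `γ > 0` such that, with high probability, every bisection
`A ∪ B` of `G(n,1/2)` satisfies `|Δ_{A,B}| < γ n^{3/2}`. -/
theorem statement1 :
    ∃ γ : ℝ, 0 < γ ∧
      Tendsto (fun n : ℕ => graphProb n (fun G => ∀ A : Finset (Fin n), IsBisection A →
          |(totalFriendliness G A : ℝ)| < γ * (n : ℝ) ^ (3 / 2 : ℝ)))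
        atTop (nhds 1) := by
  refine ⟨4, by norm_num, ?_⟩
  have hlim : Tendsto (fun n : ℕ => 1 - 2 * Real.exp (-(2 * n : ℝ))) atTop (nhds 1) := by
    have h : Tendsto (fun n : ℕ => Real.exp (-(2 * n : ℝ))) atTop (nhds 0) :=
      Real.tendsto_exp_neg_atTop_nhds_zero.comp
        (tendsto_natCast_atTop_atTop.const_mul_atTop two_pos)
    simpa using (h.const_mul 2).const_sub 1
  refine tendsto_of_tendsto_of_tendsto_of_le_of_le' hlim tendsto_const_nhds ?_
    (Eventually.of_forall fun n => graphProb_le_one n _)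
  filter_upwards [eventually_ge_atTop 1] with n hn using one_sub_le_graphProb hn
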